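/- Let n be a natural number and let f ∈ A(k) with 2^n ≤ k < 2^{n+1}. Suppose that A f A ∩ A(2^{n+1}) ⊆ A(2^n)U(2^n) + U(2^n)A(2^n), and that for all i, j ≥ 0 with i + j = k − 2^n one has f ∈ A(i)U(2^n)A(j) + U^<(i)A(k−i) + A(k−j)U^>(j). Then f ∈ E. -/

import Mathlib

/-
Formalization of statements from:
"Golod-Shafarevich algebras of a reduced number of defining relations" (A. Smoktunowicz).

`FA K` is the free associative unital `K`-algebra `A = K⟨x,y⟩` on two generators
(`FreeAlgebra.ι K 0` and `FreeAlgebra.ι K 1`), graded with the generators in degree 1.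
-/

open scoped Pointwise Classical

noncomputable section

/-- The free associative unital `K`-algebra on two generators. -/
abbrev FA (K : Type) [Field K] : Type := FreeAlgebra K (Fin 2)

variable (K : Type) [Field K]

/-- The set of monomials of degree `k` in the free algebra on two generators. -/
def Mon (k : ℕ) : Set (FA K) :=
  { m | ∃ w : List (Fin 2), w.length = k ∧ m = (w.map (FreeAlgebra.ι K)).prod }

/-- `Adeg K k` is the `k`-th homogeneous component `A(k)`: the span of the monomials of
degree `k`. -/
def Adeg (k : ℕ) : Submodule K (FA K) :=
  Submodule.span K (Mon K k)

/-- Properties (1)-(4) of the families `U(2^m)`, `V(2^m)` of subspaces of `A(2^m)`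
(Section 1 of the paper):
(1) `V(2^m)` is spanned by monomials (of degree `2^m`);
(2) `V(2^m) + U(2^m) = A(2^m)` and `V(2^m) ∩ U(2^m) = 0`;
(3) `A(2^{m-1})U(2^{m-1}) + U(2^{m-1})A(2^{m-1}) ⊆ U(2^m)`;
(4) `V(2^m) ⊆ V(2^{m-1})V(2^{m-1})`;
with `V(2^0) = Kx + Ky` and `U(2^0) = 0`. -/
def UVCond (U V : ℕ → Submodule K (FA K)) : Prop :=
  V 0 = Submodule.span K {FreeAlgebra.ι K 0, FreeAlgebra.ι K 1} ∧
  U 0 = ⊥ ∧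
  ∀ m : ℕ, 1 ≤ m →
    (∃ s ⊆ Mon K (2 ^ m), V m = Submodule.span K s) ∧
    U m ≤ Adeg K (2 ^ m) ∧
    V m ⊔ U m = Adeg K (2 ^ m) ∧
    V m ⊓ U m = ⊥ ∧
    Adeg K (2 ^ (m - 1)) * U (m - 1) ⊔ U (m - 1) * Adeg K (2 ^ (m - 1)) ≤ U m ∧
    V m ≤ V (m - 1) * V (m - 1)

/-- The homogeneous component `E(k)` (as a set), for `k ≥ 1`.  For the unique `n` with
`2^(n-1) ≤ k < 2^n` (i.e. `n = Nat.log 2 k + 1`) it consists of those `r ∈ A(k)` with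
`A r A ∩ A(2^(n+1)) ⊆ U(2^n)A(2^n) + A(2^n)U(2^n)`; here `A r A` is the two-sided ideal
generated by `r`, realized as the subspace `⊤ * span{r} * ⊤`. -/
def ESet (U : ℕ → Submodule K (FA K)) (k : ℕ) : Set (FA K) :=
  { r | r ∈ Adeg K k ∧
    (⊤ : Submodule K (FA K)) * Submodule.span K {r} * ⊤ ⊓ Adeg K (2 ^ (Nat.log 2 k + 2)) ≤
      U (Nat.log 2 k + 1) * Adeg K (2 ^ (Nat.log 2 k + 1)) ⊔
        Adeg K (2 ^ (Nat.log 2 k + 1)) * U (Nat.log 2 k + 1) }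

/-- The graded subspace `E = ⊕_{k ≥ 1} E(k)` (each `E(k)` is a subspace, so the span of the
union of the `E(k)` is their direct sum). -/
def Esub (U : ℕ → Submodule K (FA K)) : Submodule K (FA K) :=
  Submodule.span K (⋃ k ∈ Set.Ici 1, ESet K U k)

/-- Auxiliary: the product of the `V(2^p)` over the set bits of `k`, lowest bit first,
with bit positions shifted by `i`. -/
def prodLow (V : ℕ → Submodule K (FA K)) (i k : ℕ) : Submodule K (FA K) :=
  if _h : k = 0 then 1
  else (if k % 2 = 1 then V i else 1) * prodLow V (i + 1) (k / 2)
termination_by k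
decreasing_by exact Nat.div_lt_self (Nat.pos_of_ne_zero _h) one_lt_two

/-- Auxiliary: the product of the `V(2^p)` over the set bits of `k`, highest bit first. -/
def prodHigh (V : ℕ → Submodule K (FA K)) (i k : ℕ) : Submodule K (FA K) :=
  if _h : k = 0 then 1
  else prodHigh V (i + 1) (k / 2) * (if k % 2 = 1 then V i else 1)
termination_by k
decreasing_by exact Nat.div_lt_self (Nat.pos_of_ne_zero _h) one_lt_two

/-- `V^<(k) = V(2^{p_1}) ⋯ V(2^{p_t})` where `k = 2^{p_1} + ⋯ + 2^{p_t}` in binary with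
`p_1 < ⋯ < p_t`; `V^<(0) = K·1`. -/
def Vlt (V : ℕ → Submodule K (FA K)) (k : ℕ) : Submodule K (FA K) := prodLow K V 0 k

/-- `V^>(k) = V(2^{p_t}) ⋯ V(2^{p_1})`; `V^>(0) = K·1`. -/
def Vgt (V : ℕ → Submodule K (FA K)) (k : ℕ) : Submodule K (FA K) := prodHigh K V 0 k

/-- `U^<(k) = Σ_i A(2^{p_1}+⋯+2^{p_{i-1}}) U(2^{p_i}) A(2^{p_{i+1}}+⋯+2^{p_t})`
(for each set bit `p_i` of `k`, the lower part of `k` is `k % 2^{p_i}` and the upper part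
is `k - k % 2^{p_i} - 2^{p_i}`); `U^<(0) = 0`. -/
def Ult (U : ℕ → Submodule K (FA K)) (k : ℕ) : Submodule K (FA K) :=
  ⨆ (p : ℕ) (_ : k.testBit p),
    Adeg K (k % 2 ^ p) * U p * Adeg K (k - k % 2 ^ p - 2 ^ p)

/-- `U^>(k) = Σ_i A(2^{p_t}+⋯+2^{p_{i+1}}) U(2^{p_i}) A(2^{p_{i-1}}+⋯+2^{p_1})`;
`U^>(0) = 0`. -/
def Ugt (U : ℕ → Submodule K (FA K)) (k : ℕ) : Submodule K (FA K) :=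
  ⨆ (p : ℕ) (_ : k.testBit p),
    Adeg K (k - k % 2 ^ p - 2 ^ p) * U p * Adeg K (k % 2 ^ p)

/-- The Capelli polynomial
`d_n(x_1,…,x_n; y_1,…,y_n) = Σ_{σ ∈ Sym(n)} sgn(σ) x_{σ(1)} y_1 x_{σ(2)} y_2 ⋯ x_{σ(n)} y_n`,
evaluated in a ring. -/
def capelli {R : Type*} [Ring R] (n : ℕ) (x y : Fin n → R) : R :=
  ∑ σ : Equiv.Perm (Fin n),
    (Equiv.Perm.sign σ : ℤ) • ((List.finRange n).map fun i => x (σ i) * y i).prod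

/-- The quotient map `R → R ⧸ c` (for a ring congruence `c`) as a `K`-linear map. -/
def mkLin {R : Type*} [Semiring R] [Algebra K R] (c : RingCon R) :
    R →ₗ[K] c.Quotient where
  toFun := RingCon.toQuotient
  map_add' _ _ := rfl
  map_smul' _ _ := rfl

/-- A two-sided ideal of the free algebra is homogeneous iff it is spanned by its
homogeneous elements. -/
def IsHomogTSI (J : TwoSidedIdeal (FA K)) : Prop :=
  (J : Set (FA K)) ⊆ ↑(Submodule.span K {a : FA K | a ∈ J ∧ ∃ n, a ∈ Adeg K n})

/-- `S = ⋃_{n ∈ Y} {n - e(n) - 1, …, n - 1}`. -/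
def SetS (Y : Set ℕ) (e : ℕ → ℕ) : Set ℕ :=
  ⋃ n ∈ Y, Set.Icc (n - e n - 1) (n - 1)

/-- Conditions (1)-(8) of Theorem 4.1 of the paper, at index `m`, for the families
`F(2^m)`, `U(2^m)`, `V(2^m)` of subspaces of `A(2^m)`:
(1) `dim V(2^m) = 2` if `m ∉ S` and (in case `Y` is finite) `m ≤ max Y`;
(2) `dim V(2^{k-e(k)-1+j}) = 2^{2^j}` for all `k ∈ Y` and `0 ≤ j ≤ e(k)`;
(3) `V(2^m)` is spanned by monomials;
(4) `F(2^m) ⊆ U(2^m)` for `m ∈ Y`, and `F(2^m) = 0` for `m ∉ Y`;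
(5) `V(2^m) ⊕ U(2^m) = A(2^m)`;
(6) `A(2^{m-1})U(2^{m-1}) + U(2^{m-1})A(2^{m-1}) ⊆ U(2^m)`;
(7) `V(2^m) ⊆ V(2^{m-1})V(2^{m-1})`;
(8) if `Y` is finite and `m > max Y`, then `dim V(2^m) = 1`. -/
def Conds (Y : Set ℕ) (e : ℕ → ℕ) (F U V : ℕ → Submodule K (FA K)) (m : ℕ) : Prop :=
  (m ∉ SetS Y e → (Y.Finite → ∃ k ∈ Y, m ≤ k) → Module.finrank K (V m) = 2) ∧
  (∀ k ∈ Y, ∀ j ≤ e k, k - e k - 1 + j = m → Module.finrank K (V m) = 2 ^ 2 ^ j) ∧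
  (∃ s ⊆ Mon K (2 ^ m), V m = Submodule.span K s) ∧
  (m ∈ Y → F m ≤ U m) ∧ (m ∉ Y → F m = ⊥) ∧
  U m ≤ Adeg K (2 ^ m) ∧
  V m ⊔ U m = Adeg K (2 ^ m) ∧ V m ⊓ U m = ⊥ ∧
  (Adeg K (2 ^ (m - 1)) * U (m - 1) ⊔ U (m - 1) * Adeg K (2 ^ (m - 1)) ≤ U m) ∧
  V m ≤ V (m - 1) * V (m - 1) ∧
  (Y.Finite → (∀ k ∈ Y, k < m) → Module.finrank K (V m) = 1)

variable {K}

lemma Adeg_mul (a b : ℕ) : Adeg K a * Adeg K b = Adeg K (a + b) := by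
  rw [Adeg, Adeg, Adeg, Submodule.span_mul_span]
  congr 1
  ext m
  simp only [Set.mem_mul]
  constructor
  · rintro ⟨_, ⟨w, hw, rfl⟩, _, ⟨v, hv, rfl⟩, rfl⟩
    exact ⟨w ++ v, by simp [hw, hv], by simp⟩
  · rintro ⟨w, hw, rfl⟩
    refine ⟨_, ⟨w.take a, by simp [hw], rfl⟩, _, ⟨w.drop a, by simp [hw], rfl⟩, ?_⟩
    rw [← List.prod_append, ← List.map_append, List.take_append_drop]

lemma Adeg_zero : Adeg K 0 = 1 := by
  rw [Adeg, Submodule.one_eq_span]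
  congr 1
  ext m
  simp [Mon]

/-- The subspace `A(2^n)U(2^n) + U(2^n)A(2^n)`. -/
def twoBlock (U : ℕ → Submodule K (FA K)) (n : ℕ) : Submodule K (FA K) :=
  Adeg K (2 ^ n) * U n ⊔ U n * Adeg K (2 ^ n)

lemma twoBlock_le_succ {U V : ℕ → Submodule K (FA K)} (hUV : UVCond K U V) (n : ℕ) :
    twoBlock U n ≤ U (n + 1) :=
  (hUV.2.2 (n + 1) (by omega)).2.2.2.2.1

lemma aligned_le_twoBlock_of_le {U : ℕ → Submodule K (FA K)} {n p : ℕ}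
    (h : ∀ a d : ℕ, 2 ^ p ∣ a → a + 2 ^ p + d = 2 ^ n → Adeg K a * U p * Adeg K d ≤ U n)
    (hpn : p ≤ n) {a d : ℕ} (ha : 2 ^ p ∣ a) (had : a + 2 ^ p + d = 2 ^ (n + 1)) :
    Adeg K a * U p * Adeg K d ≤ twoBlock U n := by
  have hdvd : 2 ^ p ∣ 2 ^ n := pow_dvd_pow 2 hpn
  have h2 : 2 ^ (n + 1) = 2 ^ n + 2 ^ n := by ring
  by_cases hlt : 2 ^ n ≤ a
  · obtain ⟨c, rfl⟩ := Nat.exists_eq_add_of_le hlt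
    rw [← Adeg_mul, mul_assoc, mul_assoc, ← mul_assoc (Adeg K c)]
    exact (mul_le_mul_right (h c d ((Nat.dvd_add_right hdvd).1 ha) (by omega)) _).trans
      le_sup_left
  · have hle : a + 2 ^ p ≤ 2 ^ n := by
      obtain ⟨u, rfl⟩ := ha
      obtain ⟨v, hv⟩ := hdvd
      rw [hv] at hlt ⊢
      have huv : u < v := lt_of_mul_lt_mul_left (not_le.1 hlt) (Nat.zero_le _)
      rw [← Nat.mul_succ]
      exact Nat.mul_le_mul_left _ huv
    obtain ⟨c, hc⟩ := Nat.exists_eq_add_of_le hle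
    obtain rfl : d = c + 2 ^ n := by omega
    rw [← Adeg_mul, ← mul_assoc]
    exact (mul_le_mul_left (h a c ha hc.symm) _).trans le_sup_right

lemma aligned_le {U V : ℕ → Submodule K (FA K)} (hUV : UVCond K U V) {n p : ℕ} (hpn : p ≤ n) :
    ∀ a d : ℕ, 2 ^ p ∣ a → a + 2 ^ p + d = 2 ^ n → Adeg K a * U p * Adeg K d ≤ U n := by
  induction n, hpn using Nat.le_induction with
  | base =>
    intro a d _ had
    obtain rfl : a = 0 := by omega
    obtain rfl : d = 0 := by omega
    simp [Adeg_zero]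
  | succ n hpn ih =>
    intro a d ha had
    exact (aligned_le_twoBlock_of_le ih hpn ha had).trans (twoBlock_le_succ hUV n)

lemma aligned_le_twoBlock {U V : ℕ → Submodule K (FA K)} (hUV : UVCond K U V) {n p : ℕ}
    (hpn : p ≤ n) {a d : ℕ} (ha : 2 ^ p ∣ a) (had : a + 2 ^ p + d = 2 ^ (n + 1)) :
    Adeg K a * U p * Adeg K d ≤ twoBlock U n :=
  aligned_le_twoBlock_of_le (aligned_le hUV hpn) hpn ha had

lemma aligned_twoBlock_le {U V : ℕ → Submodule K (FA K)} (hUV : UVCond K U V) {n c d : ℕ}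
    (hc : 2 ^ n ∣ c) (hcd : c + 2 ^ (n + 1) + d = 2 ^ (n + 2)) :
    Adeg K c * twoBlock U n * Adeg K d ≤ twoBlock U (n + 1) := by
  have h2 : 2 ^ (n + 1) = 2 ^ n + 2 ^ n := by ring
  have h4 : 2 ^ (n + 2) = 4 * 2 ^ n := by ring
  rw [twoBlock, Submodule.mul_sup, Submodule.sup_mul]
  refine sup_le ?_ ?_
  · rw [← mul_assoc, Adeg_mul]
    exact aligned_le_twoBlock hUV (Nat.le_succ n) (dvd_add hc dvd_rfl) (by omega)
  · rw [← mul_assoc, mul_assoc, Adeg_mul]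
    exact aligned_le_twoBlock hUV (Nat.le_succ n) hc (by omega)

lemma lt_of_testBit {i p n : ℕ} (hp : i.testBit p) (hi : i < 2 ^ n) : p < n :=
  (Nat.pow_lt_pow_iff_right (by norm_num)).1 ((Nat.ge_two_pow_of_testBit hp).trans_lt hi)

lemma mod_add_two_pow_le_of_testBit {i p : ℕ} (hp : i.testBit p) : i % 2 ^ p + 2 ^ p ≤ i := by
  have h1 : 2 ^ p * 1 ≤ 2 ^ p * (i / 2 ^ p) := by
    gcongr
    exact Nat.div_pos (Nat.ge_two_pow_of_testBit hp) (by positivity)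
  have := Nat.mod_add_div i (2 ^ p)
  omega

lemma Adeg_mul_Ult_le {U V : ℕ → Submodule K (FA K)} (hUV : UVCond K U V) {n i b : ℕ}
    (hi : b + i = 2 ^ n) (hin : i < 2 ^ n) : Adeg K b * Ult K U i ≤ U n := by
  simp only [Ult, Submodule.mul_iSup]
  refine iSup₂_le fun p hp => ?_
  have hpn := lt_of_testBit hp hin
  have hle := mod_add_two_pow_le_of_testBit hp
  rw [← mul_assoc, ← mul_assoc, Adeg_mul]
  refine aligned_le hUV hpn.le _ _ ?_ (by omega)
  have h1 : 2 ^ p ∣ i - i % 2 ^ p := Nat.dvd_sub_mod i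
  have h2 : b + i % 2 ^ p = 2 ^ n - (i - i % 2 ^ p) := by omega
  rw [h2]
  exact Nat.dvd_sub (pow_dvd_pow 2 hpn.le) h1

lemma Ugt_mul_Adeg_le {U V : ℕ → Submodule K (FA K)} (hUV : UVCond K U V) {n j b : ℕ}
    (hj : j + b = 2 ^ n) (hjn : j < 2 ^ n) : Ugt K U j * Adeg K b ≤ U n := by
  simp only [Ugt, Submodule.iSup_mul]
  refine iSup₂_le fun p hp => ?_
  have hpn := lt_of_testBit hp hjn
  have hle := mod_add_two_pow_le_of_testBit hp
  rw [mul_assoc, Adeg_mul]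
  exact aligned_le hUV hpn.le _ _ (Nat.dvd_sub (Nat.dvd_sub_mod j) dvd_rfl) (by omega)

/-- The algebra map `r ↦ Σ_d r_d X^d`, where `r_d` is the degree `d` component of `r`. -/
def gradingHom : FA K →ₐ[K] Polynomial (FA K) :=
  FreeAlgebra.lift K fun i => Polynomial.monomial 1 (FreeAlgebra.ι K i)

lemma gradingHom_of_mem {d : ℕ} {r : FA K} (hr : r ∈ Adeg K d) :
    gradingHom r = Polynomial.monomial d r := by
  induction hr using Submodule.span_induction with
  | mem x hx =>
    obtain ⟨w, rfl, rfl⟩ := hx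
    induction w with
    | nil => simp
    | cons i w ih =>
      rw [List.map_cons, List.prod_cons, map_mul, ih, gradingHom, FreeAlgebra.lift_ι_apply,
        Polynomial.monomial_mul_monomial, List.length_cons, add_comm]
  | zero => simp
  | add x y _ _ hx hy => rw [map_add, hx, hy, map_add]
  | smul c x _ hx => rw [map_smul, hx, Polynomial.smul_monomial]

lemma top_eq_iSup_Adeg : (⊤ : Submodule K (FA K)) = ⨆ d, Adeg K d := by
  refine le_antisymm (fun r _ => ?_) le_top
  have hle : (⨆ d, Adeg K d) * (⨆ d, Adeg K d) ≤ ⨆ d, Adeg K d := by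
    simp only [Submodule.iSup_mul, Submodule.mul_iSup, Adeg_mul]
    exact iSup₂_le fun a b => le_iSup (Adeg K) _
  induction r using FreeAlgebra.induction with
  | grade0 c =>
    refine Submodule.mem_iSup_of_mem 0 ?_
    rw [Adeg_zero]
    exact Submodule.algebraMap_mem c
  | grade1 i =>
    exact Submodule.mem_iSup_of_mem 1 (Submodule.subset_span ⟨[i], rfl, by simp⟩)
  | mul a b ha hb => exact hle (Submodule.mul_mem_mul (ha trivial) (hb trivial))
  | add a b ha hb => exact add_mem (ha trivial) (hb trivial)

lemma ideal_inf_Adeg_le {k N : ℕ} {f : FA K} (hf : f ∈ Adeg K k) {W : Submodule K (FA K)}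
    (hW : ∀ s t : ℕ, s + k + t = N → Adeg K s * Submodule.span K {f} * Adeg K t ≤ W) :
    (⊤ : Submodule K (FA K)) * Submodule.span K {f} * ⊤ ⊓ Adeg K N ≤ W := by
  have hfk : Submodule.span K {f} ≤ Adeg K k := by simpa using hf
  have key : (⊤ : Submodule K (FA K)) * Submodule.span K {f} * ⊤ ≤
      W.comap (((Polynomial.lcoeff (FA K) N).restrictScalars K).comp
        (gradingHom (K := K)).toLinearMap) := by
    rw [top_eq_iSup_Adeg]
    simp only [Submodule.iSup_mul, Submodule.mul_iSup]
    refine iSup₂_le fun t s => ?_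
    intro r hr
    have hr' : r ∈ Adeg K (s + k + t) := by
      rw [← Adeg_mul, ← Adeg_mul]
      exact mul_le_mul_left (mul_le_mul_right hfk _) _ hr
    simp only [Submodule.mem_comap, LinearMap.comp_apply, AlgHom.toLinearMap_apply,
      LinearMap.restrictScalars_apply, Polynomial.lcoeff_apply, gradingHom_of_mem hr',
      Polynomial.coeff_monomial]
    split_ifs with h
    · exact hW s t h hr
    · exact zero_mem _
  rintro r ⟨hr, hrN⟩
  have := key hr
  simpa [gradingHom_of_mem hrN] using this

/-- If an occurrence of `f` in a word of length `2^(n+2)` covers the aligned block starting at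
`c`, with fewer than `2^n` letters on either side of it, then the word lies in
`twoBlock U (n + 1)`. -/
lemma covering_le_twoBlock {U V : ℕ → Submodule K (FA K)} (hUV : UVCond K U V)
    {n k i j s t c : ℕ} {f : FA K} (hij : i + j + 2 ^ n = k)
    (hf : f ∈ Adeg K i * U n * Adeg K j ⊔ Ult K U i * Adeg K (k - i) ⊔
      Adeg K (k - j) * Ugt K U j)
    (hi : i < 2 ^ n) (hj : j < 2 ^ n) (hc : 2 ^ n ∣ c) (hcn : 2 ^ n ≤ c) (hsi : s + i = c)
    (hst : s + k + t = 2 ^ (n + 2)) (ht : 2 ^ n ≤ j + t) :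
    Adeg K s * Submodule.span K {f} * Adeg K t ≤ twoBlock U (n + 1) := by
  have h4 : 2 ^ (n + 2) = 4 * 2 ^ n := by ring
  have hspan : Submodule.span K {f} ≤ _ := (Submodule.span_singleton_le_iff_mem _ _).2 hf
  refine (mul_le_mul_left (mul_le_mul_right hspan _) _).trans ?_
  simp only [Submodule.mul_sup, Submodule.sup_mul]
  refine sup_le (sup_le ?_ ?_) ?_
  · rw [show Adeg K s * (Adeg K i * U n * Adeg K j) * Adeg K t =
      (Adeg K s * Adeg K i) * U n * (Adeg K j * Adeg K t) by simp only [mul_assoc],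
      Adeg_mul, Adeg_mul]
    exact aligned_le_twoBlock hUV (Nat.le_succ n) (hsi ▸ hc) (by omega)
  · obtain ⟨b, hb⟩ := Nat.exists_eq_add_of_le hi.le
    obtain ⟨e, rfl⟩ := Nat.exists_eq_add_of_le' hcn
    obtain rfl : s = e + b := by omega
    rw [← Adeg_mul, show Adeg K e * Adeg K b * (Ult K U i * Adeg K (k - i)) * Adeg K t =
      Adeg K e * (Adeg K b * Ult K U i) * (Adeg K (k - i) * Adeg K t) by simp only [mul_assoc],
      Adeg_mul]
    refine (mul_le_mul_left (mul_le_mul_right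
      (Adeg_mul_Ult_le hUV (by omega) hi) _) _).trans ?_
    exact aligned_le_twoBlock hUV (Nat.le_succ n) ((Nat.dvd_add_left dvd_rfl).1 hc) (by omega)
  · obtain ⟨b, hb⟩ := Nat.exists_eq_add_of_le hj.le
    obtain ⟨e, rfl⟩ : ∃ e, t = b + e := ⟨t - b, by omega⟩
    rw [← Adeg_mul, show Adeg K s * (Adeg K (k - j) * Ugt K U j) * (Adeg K b * Adeg K e) =
      (Adeg K s * Adeg K (k - j)) * (Ugt K U j * Adeg K b) * Adeg K e by simp only [mul_assoc],
      Adeg_mul]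
    refine (mul_le_mul_left (mul_le_mul_right
      (Ugt_mul_Adeg_le hUV (by omega) hj) _) _).trans ?_
    refine aligned_le_twoBlock hUV (Nat.le_succ n) ?_ (by omega)
    rw [show s + (k - j) = c + 2 ^ n by omega]
    exact dvd_add hc dvd_rfl

/-- If an occurrence of `f` in a word of length `2^(n+2)` fits in the window of length
`2^(n+1)` starting at the multiple `c` of `2^n`, then the word lies in `twoBlock U (n + 1)`. -/
lemma window_le_twoBlock {U V : ℕ → Submodule K (FA K)} (hUV : UVCond K U V)
    {n k s t c : ℕ} {f : FA K} (hf : f ∈ Adeg K k)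
    (h : (⊤ : Submodule K (FA K)) * Submodule.span K {f} * ⊤ ⊓ Adeg K (2 ^ (n + 1)) ≤
      twoBlock U n)
    (hst : s + k + t = 2 ^ (n + 2)) (hc : 2 ^ n ∣ c) (hcs : c ≤ s)
    (hce : s + k ≤ c + 2 ^ (n + 1)) (hc2 : c + 2 ^ (n + 1) ≤ 2 ^ (n + 2)) :
    Adeg K s * Submodule.span K {f} * Adeg K t ≤ twoBlock U (n + 1) := by
  obtain ⟨a, rfl⟩ := Nat.exists_eq_add_of_le hcs
  obtain ⟨b, hb⟩ := Nat.exists_eq_add_of_le hce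
  obtain ⟨d, hd⟩ := Nat.exists_eq_add_of_le hc2
  obtain rfl : t = b + d := by omega
  rw [← Adeg_mul, ← Adeg_mul, show Adeg K c * Adeg K a * Submodule.span K {f} *
    (Adeg K b * Adeg K d) = Adeg K c * (Adeg K a * Submodule.span K {f} * Adeg K b) * Adeg K d
    by simp only [mul_assoc]]
  refine (mul_le_mul_left (mul_le_mul_right ?_ _) _).trans
    (aligned_twoBlock_le hUV hc hd.symm)
  refine (le_inf (mul_le_mul' (mul_le_mul_left le_top _) le_top) ?_).trans h
  have hfk : Submodule.span K {f} ≤ Adeg K k := by simpa using hf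
  rw [show 2 ^ (n + 1) = a + k + b by omega, ← Adeg_mul, ← Adeg_mul]
  exact mul_le_mul_left (mul_le_mul_right hfk _) _

variable (K)

/-- **Theorem 3.1.**  A criterion for membership in `E`:  if `f ∈ A(k)` with
`2^n ≤ k < 2^{n+1}`, `A f A ∩ A(2^{n+1}) ⊆ A(2^n)U(2^n) + U(2^n)A(2^n)`, and for all
`i + j = k − 2^n` one has `f ∈ A(i)U(2^n)A(j) + U^<(i)A(k−i) + A(k−j)U^>(j)`, then
`f ∈ E`. -/
theorem statement11 (U V : ℕ → Submodule K (FA K)) (hUV : UVCond K U V)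
    (n k : ℕ) (hk₁ : 2 ^ n ≤ k) (hk₂ : k < 2 ^ (n + 1))
    (f : FA K) (hf : f ∈ Adeg K k)
    (h₁ : (⊤ : Submodule K (FA K)) * Submodule.span K {f} * ⊤ ⊓ Adeg K (2 ^ (n + 1)) ≤
      Adeg K (2 ^ n) * U n ⊔ U n * Adeg K (2 ^ n))
    (h₂ : ∀ i j : ℕ, i + j = k - 2 ^ n →
      f ∈ Adeg K i * U n * Adeg K j ⊔ Ult K U i * Adeg K (k - i) ⊔
        Adeg K (k - j) * Ugt K U j) :
    f ∈ Esub K U := by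
  have hpos : 0 < 2 ^ n := by positivity
  have hlog : Nat.log 2 k = n := Nat.log_eq_of_pow_le_of_lt_pow hk₁ hk₂
  refine Submodule.subset_span (Set.mem_biUnion (x := k) (Set.mem_Ici.2 (by omega)) ⟨hf, ?_⟩)
  rw [hlog, sup_comm]
  refine ideal_inf_Adeg_le hf fun s t hst => ?_
  change _ ≤ twoBlock U (n + 1)
  have e1 : 2 ^ (n + 1) = 2 * 2 ^ n := by ring
  have e2 : 2 ^ (n + 2) = 4 * 2 ^ n := by ring
  by_cases hA : s + k ≤ 2 * 2 ^ n
  · exact window_le_twoBlock hUV hf h₁ hst (dvd_zero _) (Nat.zero_le s) (by omega) (by omega)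
  by_cases hB : 2 * 2 ^ n ≤ s
  · exact window_le_twoBlock hUV hf h₁ hst (dvd_mul_left _ 2) hB (by omega) (by omega)
  by_cases hC : s < 2 ^ n
  · exact covering_le_twoBlock hUV (i := 2 ^ n - s) (j := s + k - 2 * 2 ^ n) (by omega)
      (h₂ _ _ (by omega)) (by omega) (by omega) dvd_rfl le_rfl (by omega) hst (by omega)
  by_cases hD : s + k ≤ 3 * 2 ^ n
  · exact window_le_twoBlock hUV hf h₁ hst dvd_rfl (not_lt.1 hC) (by omega) (by omega)
  · exact covering_le_twoBlock hUV (i := 2 * 2 ^ n - s) (j := s + k - 3 * 2 ^ n) (by omega)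
      (h₂ _ _ (by omega)) (by omega) (by omega) (dvd_mul_left _ 2) (by omega) (by omega) hst
      (by omega)

end
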